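/- arXiv:1807.05340 — 3 statements merged into one kernel-verified Lean document; each statement's English description precedes it below -/
import Mathlib

section
/- Fix integers 0 < m < n and for each positive integer k define ψ_k(ε) = (2Γ(kn/2)/(Γ(km/2)Γ((kn−km)/2))) ∫₀^ε t^{km−1}/(1+t²)^{kn/2} dt, and set ε₀ = √(m/(n−m)). Then for every ε with 0 < ε < ε₀ one has ψ_k(ε) → 0 as k → ∞, and for every ε > ε₀ one has ψ_k(ε) → 1 as k → ∞. Moreover, the convergence is exponential outside any interval around ε₀: for every open interval around ε₀ there exist a constant C and a q < 1 such that for all k, ψ_k(ε) ≤ C√k·q^{k−1} for all ε > 0 left of the interval and 1 − ψ_k(ε) ≤ C√k·q^{k−1} for all ε right of the interval. -/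
open MeasureTheory Real Filter

/-- The function `ψ(ε) = (2Γ(n/2)/(Γ(m/2)Γ((n-m)/2))) ∫₀^ε t^{m-1}/(1+t²)^{n/2} dt`. -/
noncomputable def psiFun (m n : ℕ) (ε : ℝ) : ℝ :=
  2 * Real.Gamma ((n : ℝ) / 2) /
      (Real.Gamma ((m : ℝ) / 2) * Real.Gamma (((n : ℝ) - (m : ℝ)) / 2)) *
    ∫ t in (0 : ℝ)..ε, t ^ (m - 1) / (1 + t ^ 2) ^ ((n : ℝ) / 2)

open ProbabilityTheory in
lemma integrable_betaPDFReal {α β : ℝ} (hα : 0 < α) (hβ : 0 < β) :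
    Integrable (betaPDFReal α β) := by
  refine ⟨(measurable_betaPDFReal α β).aestronglyMeasurable, ?_⟩
  rw [hasFiniteIntegral_iff_ofReal (ae_of_all _ fun x => ?_)]
  · exact (lintegral_betaPDF_eq_one hα hβ).trans_lt ENNReal.one_lt_top
  · by_cases hx : 0 < x ∧ x < 1
    · exact (betaPDFReal_pos hx.1 hx.2 hα hβ).le
    · simp [betaPDFReal, hx]

open ProbabilityTheory in
lemma integral_betaPDFReal {α β : ℝ} (hα : 0 < α) (hβ : 0 < β) :
    ∫ x, betaPDFReal α β x = 1 := by
  rw [integral_eq_lintegral_of_nonneg_ae (ae_of_all _ fun x => ?_)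
    (measurable_betaPDFReal α β).aestronglyMeasurable]
  · exact (congrArg ENNReal.toReal (lintegral_betaPDF_eq_one hα hβ)).trans ENNReal.toReal_one
  · by_cases hx : 0 < x ∧ x < 1
    · exact (betaPDFReal_pos hx.1 hx.2 hα hβ).le
    · simp [betaPDFReal, hx]

lemma image_sq_div_one_add_sq :
    (fun t : ℝ => t ^ 2 / (1 + t ^ 2)) '' Set.Ioi 0 = Set.Ioo 0 1 := by
  ext x
  constructor
  · rintro ⟨t, ht, rfl⟩
    have ht : 0 < t := ht
    refine ⟨by positivity, ?_⟩
    change t ^ 2 / (1 + t ^ 2) < 1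
    rw [div_lt_one (by positivity)]
    linarith
  · rintro ⟨h0, h1⟩
    have h1' : 0 < 1 - x := by linarith
    refine ⟨√(x / (1 - x)), Real.sqrt_pos.2 (by positivity), ?_⟩
    simp only [Real.sq_sqrt (div_pos h0 h1').le]
    field_simp
    ring

lemma injOn_sq_div_one_add_sq :
    Set.InjOn (fun t : ℝ => t ^ 2 / (1 + t ^ 2)) (Set.Ioi 0) := by
  intro x hx y hy h
  have hx : 0 < x := hx
  have hy : 0 < y := hy
  simp only at h
  rw [div_eq_div_iff (by positivity) (by positivity)] at h
  exact (sq_eq_sq₀ hx.le hy.le).1 (by linarith)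

lemma hasDerivAt_sq_div_one_add_sq (t : ℝ) :
    HasDerivAt (fun t : ℝ => t ^ 2 / (1 + t ^ 2)) (2 * t / (1 + t ^ 2) ^ 2) t := by
  have h := (hasDerivAt_pow 2 t).div ((hasDerivAt_pow 2 t).const_add 1)
    (by positivity : (1 + t ^ 2 : ℝ) ≠ 0)
  refine h.congr_deriv ?_
  congr 1
  push_cast
  ring

open ProbabilityTheory in
lemma deriv_smul_betaPDFReal_comp {p n : ℕ} (hp : 0 < p) {t : ℝ} (ht : 0 < t) :
    |2 * t / (1 + t ^ 2) ^ 2| •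
        betaPDFReal ((p : ℝ) / 2) (((n : ℝ) - p) / 2) (t ^ 2 / (1 + t ^ 2)) =
      2 / beta ((p : ℝ) / 2) (((n : ℝ) - p) / 2) *
        (t ^ (p - 1) / (1 + t ^ 2) ^ ((n : ℝ) / 2)) := by
  have hu : 0 < 1 + t ^ 2 := by positivity
  have hlt : t ^ 2 / (1 + t ^ 2) < 1 := by rw [div_lt_one hu]; linarith
  have h1 : 1 - t ^ 2 / (1 + t ^ 2) = (1 + t ^ 2)⁻¹ := by field_simp; ring
  rw [betaPDFReal, if_pos ⟨by positivity, hlt⟩, h1, abs_of_nonneg (by positivity), smul_eq_mul,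
    Real.div_rpow (by positivity) hu.le, Real.inv_rpow hu.le, ← Real.rpow_natCast_mul ht.le,
    ← Real.rpow_natCast t (p - 1), Nat.cast_pred hp]
  have e1 : ((2 : ℕ) : ℝ) * ((p : ℝ) / 2 - 1) = (p - 1 : ℝ) - 1 := by push_cast; ring
  have e2 : (n : ℝ) / 2 = ((p : ℝ) / 2 - 1) + (((n : ℝ) - p) / 2 - 1) + (2 : ℕ) := by
    push_cast; ring
  rw [e1, Real.rpow_sub_one ht.ne', e2, Real.rpow_add_natCast hu.ne', Real.rpow_add hu]
  field_simp

open ProbabilityTheory in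
lemma integrableOn_pow_div_one_add_sq_rpow {p n : ℕ} (hp : 0 < p) (hpn : p < n) :
    IntegrableOn (fun t : ℝ => t ^ (p - 1) / (1 + t ^ 2) ^ ((n : ℝ) / 2)) (Set.Ioi 0) := by
  have hα : (0 : ℝ) < (p : ℝ) / 2 := by positivity
  have hβ : 0 < ((n : ℝ) - p) / 2 := by
    have : (p : ℝ) < n := by exact_mod_cast hpn
    linarith
  have h := (integrableOn_image_iff_integrableOn_abs_deriv_smul measurableSet_Ioi
    (fun t _ => (hasDerivAt_sq_div_one_add_sq t).hasDerivWithinAt) injOn_sq_div_one_add_sq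
    (betaPDFReal ((p : ℝ) / 2) (((n : ℝ) - p) / 2))).1
      (integrable_betaPDFReal hα hβ).integrableOn
  replace h := h.congr_fun (fun t ht => deriv_smul_betaPDFReal_comp (n := n) hp ht)
    measurableSet_Ioi
  have hb := beta_pos hα hβ
  exact (integrable_const_mul_iff (by rw [isUnit_iff_ne_zero]; positivity) _).1 h

open ProbabilityTheory in
lemma integral_pow_div_one_add_sq_rpow {p n : ℕ} (hp : 0 < p) (hpn : p < n) :
    2 / beta ((p : ℝ) / 2) (((n : ℝ) - p) / 2) *
      ∫ t in Set.Ioi (0 : ℝ), t ^ (p - 1) / (1 + t ^ 2) ^ ((n : ℝ) / 2) = 1 := by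
  have hα : (0 : ℝ) < (p : ℝ) / 2 := by positivity
  have hβ : 0 < ((n : ℝ) - p) / 2 := by
    have : (p : ℝ) < n := by exact_mod_cast hpn
    linarith
  have h := integral_image_eq_integral_abs_deriv_smul measurableSet_Ioi
    (fun t _ => (hasDerivAt_sq_div_one_add_sq t).hasDerivWithinAt) injOn_sq_div_one_add_sq
    (betaPDFReal ((p : ℝ) / 2) (((n : ℝ) - p) / 2))
  rw [setIntegral_congr_fun measurableSet_Ioi
    (fun t ht => deriv_smul_betaPDFReal_comp hp ht), integral_const_mul,
    image_sq_div_one_add_sq, setIntegral_eq_integral_of_forall_compl_eq_zero,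
    integral_betaPDFReal hα hβ] at h
  · exact h.symm
  · intro x hx
    exact if_neg hx

/-- `psiFun p n ε` is the fraction of the total mass of its integrand lying in `(0, ε]`. -/
lemma psiFun_eq_div {p n : ℕ} (hp : 0 < p) (hpn : p < n) {ε : ℝ} (hε : 0 ≤ ε) :
    psiFun p n ε = (∫ t in Set.Ioc 0 ε, t ^ (p - 1) / (1 + t ^ 2) ^ ((n : ℝ) / 2)) /
      ∫ t in Set.Ioi (0 : ℝ), t ^ (p - 1) / (1 + t ^ 2) ^ ((n : ℝ) / 2) := by
  have h := integral_pow_div_one_add_sq_rpow hp hpn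
  have hne : ∫ t in Set.Ioi (0 : ℝ), t ^ (p - 1) / (1 + t ^ 2) ^ ((n : ℝ) / 2) ≠ 0 :=
    right_ne_zero_of_mul (h.trans_ne one_ne_zero)
  rw [psiFun, intervalIntegral.integral_of_le hε, eq_div_iff hne, mul_right_comm]
  rw [ProbabilityTheory.beta, show (p : ℝ) / 2 + ((n : ℝ) - p) / 2 = n / 2 by ring,
    div_div_eq_mul_div] at h
  rw [h, one_mul]

lemma one_sub_psiFun_eq_div {p n : ℕ} (hp : 0 < p) (hpn : p < n) {ε : ℝ} (hε : 0 ≤ ε) :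
    1 - psiFun p n ε = (∫ t in Set.Ioi ε, t ^ (p - 1) / (1 + t ^ 2) ^ ((n : ℝ) / 2)) /
      ∫ t in Set.Ioi (0 : ℝ), t ^ (p - 1) / (1 + t ^ 2) ^ ((n : ℝ) / 2) := by
  have hI := integrableOn_pow_div_one_add_sq_rpow hp hpn
  have hne : ∫ t in Set.Ioi (0 : ℝ), t ^ (p - 1) / (1 + t ^ 2) ^ ((n : ℝ) / 2) ≠ 0 :=
    right_ne_zero_of_mul ((integral_pow_div_one_add_sq_rpow hp hpn).trans_ne one_ne_zero)
  rw [psiFun_eq_div hp hpn hε, one_sub_div hne]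
  congr 1
  have hu : Set.Ioc 0 ε ∪ Set.Ioi ε = Set.Ioi 0 := Set.Ioc_union_Ioi_eq_Ioi hε
  rw [← hu, setIntegral_union (Set.Ioc_disjoint_Ioi le_rfl) measurableSet_Ioi
    (hI.mono_set Set.Ioc_subset_Ioi_self) (hI.mono_set (Set.Ioi_subset_Ioi hε)),
    add_sub_cancel_left]

lemma psiFun_nonneg {p n : ℕ} (hp : 0 < p) (hpn : p < n) {ε : ℝ} (hε : 0 ≤ ε) :
    0 ≤ psiFun p n ε := by
  rw [psiFun_eq_div hp hpn hε]
  refine div_nonneg (setIntegral_nonneg measurableSet_Ioc fun t ht => ?_)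
    (setIntegral_nonneg measurableSet_Ioi fun t ht => ?_)
  · have := ht.1
    positivity
  · have : 0 < t := ht
    positivity

lemma psiFun_le_one {p n : ℕ} (hp : 0 < p) (hpn : p < n) {ε : ℝ} (hε : 0 ≤ ε) :
    psiFun p n ε ≤ 1 := by
  rw [← sub_nonneg, one_sub_psiFun_eq_div hp hpn hε]
  refine div_nonneg (setIntegral_nonneg measurableSet_Ioi fun t ht => ?_)
    (setIntegral_nonneg measurableSet_Ioi fun t ht => ?_)
  · have : 0 < t := hε.trans_lt ht
    positivity
  · have : 0 < t := ht
    positivity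

lemma hasDerivAt_log_pow_div_one_add_sq_rpow (m n : ℕ) {t : ℝ} (ht : 0 < t) :
    HasDerivAt (fun t : ℝ => (m : ℝ) * Real.log t - (n : ℝ) / 2 * Real.log (1 + t ^ 2))
      ((m - (n - m) * t ^ 2) / (t * (1 + t ^ 2))) t := by
  have hu : 0 < 1 + t ^ 2 := by positivity
  have h := ((Real.hasDerivAt_log ht.ne').const_mul (m : ℝ)).sub
    ((((hasDerivAt_pow 2 t).const_add 1).log hu.ne').const_mul ((n : ℝ) / 2))
  refine h.congr_deriv ?_
  push_cast
  field_simp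
  ring

lemma exp_log_pow_div_one_add_sq_rpow (m n : ℕ) {t : ℝ} (ht : 0 < t) :
    Real.exp ((m : ℝ) * Real.log t - (n : ℝ) / 2 * Real.log (1 + t ^ 2)) =
      t ^ m / (1 + t ^ 2) ^ ((n : ℝ) / 2) := by
  rw [Real.exp_sub, mul_comm, ← Real.rpow_def_of_pos ht, Real.rpow_natCast,
    mul_comm, ← Real.rpow_def_of_pos (by positivity)]

lemma strictMonoOn_pow_div_one_add_sq_rpow {m n : ℕ} (hmn : m < n) :
    StrictMonoOn (fun t : ℝ => t ^ m / (1 + t ^ 2) ^ ((n : ℝ) / 2))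
      (Set.Ioc 0 √((m : ℝ) / ((n : ℝ) - m))) := by
  have hnm : (0 : ℝ) < n - m := sub_pos.2 (by exact_mod_cast hmn)
  refine StrictMonoOn.congr (f₁ := fun t : ℝ => Real.exp ((m : ℝ) * Real.log t -
    (n : ℝ) / 2 * Real.log (1 + t ^ 2))) (Real.exp_strictMono.comp_strictMonoOn ?_)
    fun t ht => exp_log_pow_div_one_add_sq_rpow m n ht.1
  refine strictMonoOn_of_deriv_pos (convex_Ioc _ _) (fun t ht =>
    (hasDerivAt_log_pow_div_one_add_sq_rpow m n ht.1).continuousAt.continuousWithinAt) ?_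
  intro t ht
  rw [interior_Ioc] at ht
  rw [(hasDerivAt_log_pow_div_one_add_sq_rpow m n ht.1).deriv]
  have ht0 := ht.1
  have h := (Real.lt_sqrt ht0.le).1 ht.2
  rw [lt_div_iff₀ hnm] at h
  exact div_pos (by linarith) (by positivity)

lemma strictAntiOn_pow_div_one_add_sq_rpow {m n : ℕ} (hm : 0 < m) (hmn : m < n) :
    StrictAntiOn (fun t : ℝ => t ^ m / (1 + t ^ 2) ^ ((n : ℝ) / 2))
      (Set.Ici √((m : ℝ) / ((n : ℝ) - m))) := by
  have hnm : (0 : ℝ) < n - m := sub_pos.2 (by exact_mod_cast hmn)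
  have hpos : 0 < √((m : ℝ) / ((n : ℝ) - m)) := Real.sqrt_pos.2 (by positivity)
  refine StrictAntiOn.congr (f₁ := fun t : ℝ => Real.exp ((m : ℝ) * Real.log t -
    (n : ℝ) / 2 * Real.log (1 + t ^ 2))) (Real.exp_strictMono.comp_strictAntiOn ?_)
    fun t ht => exp_log_pow_div_one_add_sq_rpow m n (hpos.trans_le ht)
  refine strictAntiOn_of_deriv_neg (convex_Ici _) (fun t ht =>
    (hasDerivAt_log_pow_div_one_add_sq_rpow m n
      (hpos.trans_le ht)).continuousAt.continuousWithinAt) ?_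
  intro t ht
  rw [interior_Ici] at ht
  have ht0 : 0 < t := hpos.trans ht
  rw [(hasDerivAt_log_pow_div_one_add_sq_rpow m n ht0).deriv]
  have h := (Real.sqrt_lt' ht0).1 ht
  rw [div_lt_iff₀ hnm] at h
  exact div_neg_of_neg_of_pos (by linarith) (by positivity)

/-- If `F ≤ A` on `s` and `c ≤ F` on `r`, then the fraction of the mass of `F ^ j * G` lying in
`s` is at most a constant times `(A / c) ^ j`. -/
lemma setIntegral_pow_mul_div_le {F G : ℝ → ℝ} {s r S : Set ℝ} {A c : ℝ} {j : ℕ}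
    (hS : MeasurableSet S) (hs : MeasurableSet s) (hr : MeasurableSet r)
    (hsS : s ⊆ S) (hrS : r ⊆ S) (hF : ∀ t ∈ S, 0 ≤ F t) (hG : ∀ t ∈ S, 0 ≤ G t)
    (hGi : IntegrableOn G S) (hFGi : IntegrableOn (fun t => F t ^ j * G t) S)
    (hA : ∀ t ∈ s, F t ≤ A) (hA0 : 0 ≤ A) (hc0 : 0 < c) (hc : ∀ t ∈ r, c ≤ F t)
    (hr0 : 0 < ∫ t in r, G t) :
    (∫ t in s, F t ^ j * G t) / ∫ t in S, F t ^ j * G t ≤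
      (∫ t in S, G t) / (∫ t in r, G t) * (A / c) ^ j := by
  have num : ∫ t in s, F t ^ j * G t ≤ A ^ j * ∫ t in S, G t := by
    calc ∫ t in s, F t ^ j * G t ≤ ∫ t in s, A ^ j * G t :=
          setIntegral_mono_on (hFGi.mono_set hsS) ((hGi.mono_set hsS).const_mul _) hs
            fun t ht => mul_le_mul_of_nonneg_right
              (pow_le_pow_left₀ (hF t (hsS ht)) (hA t ht) j) (hG t (hsS ht))
      _ = A ^ j * ∫ t in s, G t := integral_const_mul _ _
      _ ≤ A ^ j * ∫ t in S, G t := mul_le_mul_of_nonneg_left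
          (setIntegral_mono_set hGi ((ae_restrict_iff' hS).2 (ae_of_all _ hG))
            hsS.eventuallyLE) (by positivity)
  have den : c ^ j * ∫ t in r, G t ≤ ∫ t in S, F t ^ j * G t := by
    calc c ^ j * ∫ t in r, G t = ∫ t in r, c ^ j * G t := (integral_const_mul _ _).symm
      _ ≤ ∫ t in r, F t ^ j * G t :=
          setIntegral_mono_on ((hGi.mono_set hrS).const_mul _) (hFGi.mono_set hrS) hr
            fun t ht => mul_le_mul_of_nonneg_right
              (pow_le_pow_left₀ hc0.le (hc t ht) j) (hG t (hrS ht))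
      _ ≤ ∫ t in S, F t ^ j * G t :=
          setIntegral_mono_set hFGi ((ae_restrict_iff' hS).2 (ae_of_all _ fun t ht =>
            mul_nonneg (pow_nonneg (hF t ht) j) (hG t ht))) hrS.eventuallyLE
  have hI : 0 ≤ ∫ t in S, G t := setIntegral_nonneg hS hG
  calc (∫ t in s, F t ^ j * G t) / ∫ t in S, F t ^ j * G t
      ≤ (A ^ j * ∫ t in S, G t) / (c ^ j * ∫ t in r, G t) :=
        div_le_div₀ (by positivity) num (by positivity) den
    _ = _ := by rw [div_pow]; field_simp

lemma pow_div_one_add_sq_rpow_mul_succ {m : ℕ} (hm : 0 < m) (n j : ℕ) (t : ℝ) :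
    t ^ ((j + 1) * m - 1) / (1 + t ^ 2) ^ ((((j + 1) * n : ℕ) : ℝ) / 2) =
      (t ^ m / (1 + t ^ 2) ^ ((n : ℝ) / 2)) ^ j *
        (t ^ (m - 1) / (1 + t ^ 2) ^ ((n : ℝ) / 2)) := by
  have hu : 0 < 1 + t ^ 2 := by positivity
  have e1 : (j + 1) * m - 1 = m * j + (m - 1) := by
    rw [Nat.add_mul, one_mul, Nat.add_sub_assoc hm, mul_comm]
  have e2 : (((j + 1) * n : ℕ) : ℝ) / 2 = (n : ℝ) / 2 * j + (n : ℝ) / 2 := by push_cast; ring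
  rw [e1, e2, pow_add, pow_mul, Real.rpow_add hu, Real.rpow_mul_natCast hu.le, div_pow,
    div_mul_div_comm]

lemma setIntegral_Ioc_pow_div_one_add_sq_rpow_pos {m n : ℕ} (hm : 0 < m) (hmn : m < n)
    {x y : ℝ} (hx : 0 < x) (hxy : x < y) :
    0 < ∫ t in Set.Ioc x y, t ^ (m - 1) / (1 + t ^ 2) ^ ((n : ℝ) / 2) := by
  have hI := (integrableOn_pow_div_one_add_sq_rpow hm hmn).mono_set
    (fun t (ht : t ∈ Set.Ioc x y) => hx.trans ht.1)
  rw [← intervalIntegral.integral_of_le hxy.le]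
  refine intervalIntegral.intervalIntegral_pos_of_pos_on
    ((intervalIntegrable_iff_integrableOn_Ioc_of_le hxy.le).2 hI) (fun t ht => ?_) hxy
  have : 0 < t := hx.trans ht.1
  positivity

lemma exists_psiFun_le {m n : ℕ} (hm : 0 < m) (hmn : m < n) {a : ℝ} (ha : 0 < a)
    (ha' : a < √((m : ℝ) / ((n : ℝ) - m))) :
    ∃ C q : ℝ, 0 < C ∧ 0 ≤ q ∧ q < 1 ∧ ∀ j : ℕ, ∀ ε : ℝ, 0 < ε → ε ≤ a →
      psiFun ((j + 1) * m) ((j + 1) * n) ε ≤ C * q ^ j := by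
  obtain ⟨c, hac, hc⟩ := exists_between ha'
  have hmono := strictMonoOn_pow_div_one_add_sq_rpow hmn
  have hc0 := ha.trans hac
  have hr0 := setIntegral_Ioc_pow_div_one_add_sq_rpow_pos hm hmn hc0 hc
  have hGi := integrableOn_pow_div_one_add_sq_rpow hm hmn
  have hS0 : 0 < ∫ t in Set.Ioi (0 : ℝ), t ^ (m - 1) / (1 + t ^ 2) ^ ((n : ℝ) / 2) := by
    refine hr0.trans_le (setIntegral_mono_set hGi ((ae_restrict_iff' measurableSet_Ioi).2
      (ae_of_all _ fun t (ht : 0 < t) => ?_))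
      (Set.Ioc_subset_Ioi_self.trans (Set.Ioi_subset_Ioi hc0.le)).eventuallyLE)
    change 0 ≤ t ^ (m - 1) / (1 + t ^ 2) ^ ((n : ℝ) / 2)
    positivity
  refine ⟨_, (a ^ m / (1 + a ^ 2) ^ ((n : ℝ) / 2)) / (c ^ m / (1 + c ^ 2) ^ ((n : ℝ) / 2)),
    div_pos hS0 hr0, by positivity,
    (div_lt_one (by positivity)).2 (hmono ⟨ha, ha'.le⟩ ⟨hc0, hc.le⟩ hac), ?_⟩
  intro j ε hε hεa
  have hFGi := integrableOn_pow_div_one_add_sq_rpow (Nat.mul_pos j.succ_pos hm)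
    (Nat.mul_lt_mul_of_pos_left hmn j.succ_pos)
  rw [psiFun_eq_div (Nat.mul_pos j.succ_pos hm)
    (Nat.mul_lt_mul_of_pos_left hmn j.succ_pos) hε.le]
  simp only [Nat.succ_eq_add_one, pow_div_one_add_sq_rpow_mul_succ hm] at hFGi ⊢
  refine setIntegral_pow_mul_div_le measurableSet_Ioi measurableSet_Ioc measurableSet_Ioc
    Set.Ioc_subset_Ioi_self (Set.Ioc_subset_Ioi_self.trans (Set.Ioi_subset_Ioi hc0.le))
    (fun t (ht : 0 < t) => by positivity) (fun t (ht : 0 < t) => by positivity) hGi hFGi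
    (fun t ht => ?_) (by positivity) (by positivity) (fun t ht => ?_) hr0
  · exact hmono.monotoneOn ⟨ht.1, (ht.2.trans hεa).trans ha'.le⟩ ⟨ha, ha'.le⟩ (ht.2.trans hεa)
  · exact hmono.monotoneOn ⟨hc0, hc.le⟩ ⟨hc0.trans ht.1, ht.2⟩ ht.1.le

lemma exists_one_sub_psiFun_le {m n : ℕ} (hm : 0 < m) (hmn : m < n) {b : ℝ}
    (hb : √((m : ℝ) / ((n : ℝ) - m)) < b) :
    ∃ C q : ℝ, 0 < C ∧ 0 ≤ q ∧ q < 1 ∧ ∀ j : ℕ, ∀ ε : ℝ, b ≤ ε →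
      1 - psiFun ((j + 1) * m) ((j + 1) * n) ε ≤ C * q ^ j := by
  obtain ⟨d, hd, hdb⟩ := exists_between hb
  have hanti := strictAntiOn_pow_div_one_add_sq_rpow hm hmn
  have hnm : (0 : ℝ) < n - m := sub_pos.2 (by exact_mod_cast hmn)
  have he0 : 0 < √((m : ℝ) / ((n : ℝ) - m)) := Real.sqrt_pos.2 (by positivity)
  have hd0 := he0.trans hd
  have hb0 := he0.trans hb
  have hr0 := setIntegral_Ioc_pow_div_one_add_sq_rpow_pos hm hmn he0 hd
  have hGi := integrableOn_pow_div_one_add_sq_rpow hm hmn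
  have hS0 : 0 < ∫ t in Set.Ioi (0 : ℝ), t ^ (m - 1) / (1 + t ^ 2) ^ ((n : ℝ) / 2) := by
    refine hr0.trans_le (setIntegral_mono_set hGi ((ae_restrict_iff' measurableSet_Ioi).2
      (ae_of_all _ fun t (ht : 0 < t) => ?_))
      (Set.Ioc_subset_Ioi_self.trans (Set.Ioi_subset_Ioi he0.le)).eventuallyLE)
    change 0 ≤ t ^ (m - 1) / (1 + t ^ 2) ^ ((n : ℝ) / 2)
    positivity
  refine ⟨_, (b ^ m / (1 + b ^ 2) ^ ((n : ℝ) / 2)) / (d ^ m / (1 + d ^ 2) ^ ((n : ℝ) / 2)),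
    div_pos hS0 hr0, by positivity,
    (div_lt_one (by positivity)).2 (hanti hd.le hb.le hdb), ?_⟩
  intro j ε hbε
  have hε := hb0.trans_le hbε
  have hFGi := integrableOn_pow_div_one_add_sq_rpow (Nat.mul_pos j.succ_pos hm)
    (Nat.mul_lt_mul_of_pos_left hmn j.succ_pos)
  rw [one_sub_psiFun_eq_div (Nat.mul_pos j.succ_pos hm)
    (Nat.mul_lt_mul_of_pos_left hmn j.succ_pos) hε.le]
  simp only [Nat.succ_eq_add_one, pow_div_one_add_sq_rpow_mul_succ hm] at hFGi ⊢
  refine setIntegral_pow_mul_div_le measurableSet_Ioi measurableSet_Ioi measurableSet_Ioc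
    (Set.Ioi_subset_Ioi hε.le) (Set.Ioc_subset_Ioi_self.trans (Set.Ioi_subset_Ioi he0.le))
    (fun t (ht : 0 < t) => by positivity) (fun t (ht : 0 < t) => by positivity) hGi hFGi
    (fun t ht => ?_) (by positivity) (by positivity) (fun t ht => ?_) hr0
  · have hbt : b ≤ t := hbε.trans (le_of_lt ht)
    exact hanti.antitoneOn hb.le (hb.le.trans hbt) hbt
  · exact hanti.antitoneOn (Set.mem_Ici.2 ht.1.le) hd.le ht.2

/-- **Lemma 6.1.**  Fix `0 < m < n` and set `ψ_k = psiFun (km) (kn)` and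
`ε₀ = √(m/(n-m))`.  Then `ψ_k(ε) → 0` for `0 < ε < ε₀`, `ψ_k(ε) → 1` for `ε > ε₀`, and
outside any interval around `ε₀` the convergence is exponential: there are `C` and `q < 1`
with `ψ_k(ε) ≤ C√k q^{k-1}` left of the interval and `1 - ψ_k(ε) ≤ C√k q^{k-1}` right of
it, for all `k`. -/
theorem psi_jump_limit
    (m n : ℕ) (hm : 0 < m) (hmn : m < n) :
    (∀ ε : ℝ, 0 < ε → ε < Real.sqrt ((m : ℝ) / ((n : ℝ) - (m : ℝ))) →
      Tendsto (fun k : ℕ => psiFun (k * m) (k * n) ε) atTop (nhds 0)) ∧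
    (∀ ε : ℝ, Real.sqrt ((m : ℝ) / ((n : ℝ) - (m : ℝ))) < ε →
      Tendsto (fun k : ℕ => psiFun (k * m) (k * n) ε) atTop (nhds 1)) ∧
    (∀ a b : ℝ, 0 < a → a < Real.sqrt ((m : ℝ) / ((n : ℝ) - (m : ℝ))) →
      Real.sqrt ((m : ℝ) / ((n : ℝ) - (m : ℝ))) < b →
      ∃ C q : ℝ, 0 < C ∧ 0 ≤ q ∧ q < 1 ∧
        ∀ k : ℕ, 1 ≤ k →
          (∀ ε : ℝ, 0 < ε → ε ≤ a →
            psiFun (k * m) (k * n) ε ≤ C * Real.sqrt k * q ^ (k - 1)) ∧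
          (∀ ε : ℝ, b ≤ ε →
            1 - psiFun (k * m) (k * n) ε ≤ C * Real.sqrt k * q ^ (k - 1))) := by
  have hpow : ∀ C q : ℝ, 0 ≤ q → q < 1 → Tendsto (fun j : ℕ => C * q ^ j) atTop (nhds 0) :=
    fun C q hq0 hq1 => by
      simpa using (tendsto_pow_atTop_nhds_zero_of_lt_one hq0 hq1).const_mul C
  refine ⟨fun ε hε hε' => ?_, fun ε hε => ?_, fun a b ha ha' hb => ?_⟩
  · obtain ⟨C, q, -, hq0, hq1, h⟩ := exists_psiFun_le hm hmn hε hε'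
    rw [← tendsto_add_atTop_iff_nat 1]
    exact squeeze_zero (fun j => psiFun_nonneg (Nat.mul_pos j.succ_pos hm)
      (Nat.mul_lt_mul_of_pos_left hmn j.succ_pos) hε.le) (fun j => h j ε hε le_rfl)
      (hpow C q hq0 hq1)
  · obtain ⟨C, q, -, hq0, hq1, h⟩ := exists_one_sub_psiFun_le hm hmn hε
    have hε0 : 0 ≤ ε := (Real.sqrt_nonneg _).trans hε.le
    rw [← tendsto_add_atTop_iff_nat 1]
    have := squeeze_zero (fun j => sub_nonneg.2 (psiFun_le_one (Nat.mul_pos j.succ_pos hm)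
      (Nat.mul_lt_mul_of_pos_left hmn j.succ_pos) hε0)) (fun j => h j ε le_rfl)
      (hpow C q hq0 hq1)
    simpa using this.const_sub 1
  · obtain ⟨C₁, q₁, hC₁, hq₁0, hq₁1, h₁⟩ := exists_psiFun_le hm hmn ha ha'
    obtain ⟨C₂, q₂, hC₂, hq₂0, hq₂1, h₂⟩ := exists_one_sub_psiFun_le hm hmn hb
    refine ⟨max C₁ C₂, max q₁ q₂, lt_max_of_lt_left hC₁, le_max_of_le_left hq₁0,
      max_lt hq₁1 hq₂1, fun k hk => ?_⟩
    obtain ⟨j, rfl⟩ := Nat.exists_eq_add_of_le' hk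
    have hsqrt : 1 ≤ √((j + 1 : ℕ) : ℝ) := Real.one_le_sqrt.2 (by exact_mod_cast hk)
    have key : ∀ C q : ℝ, 0 < C → 0 ≤ q → C ≤ max C₁ C₂ → q ≤ max q₁ q₂ →
        C * q ^ j ≤ max C₁ C₂ * √((j + 1 : ℕ) : ℝ) * max q₁ q₂ ^ j := by
      intro C q hC hq hCm hqm
      have hC' := hC.trans_le hCm
      exact mul_le_mul (hCm.trans (le_mul_of_one_le_right hC'.le hsqrt))
        (pow_le_pow_left₀ hq hqm j) (by positivity) (by positivity)
    rw [Nat.add_sub_cancel]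
    exact ⟨fun ε hε hεa => (h₁ j ε hε hεa).trans
        (key C₁ q₁ hC₁ hq₁0 (le_max_left _ _) (le_max_left _ _)),
      fun ε hε => (h₂ j ε hε).trans
        (key C₂ q₂ hC₂ hq₂0 (le_max_right _ _) (le_max_right _ _))⟩
end

section
/- For integers 0 < m < n let 2β = (n/m)·ln(n/m) − (n/m − 1)·ln(n/m − 1). Then e^{−β} = ϑ(m/n)·√(m/n), where ϑ : (0,1) → ℝ is defined by ϑ(x) = exp((1−x)ln(1−x)/(2x)). The function ϑ is monotonically increasing on (0,1), satisfies ϑ(x) → 1/√e as x → 0⁺, and ϑ(x) → 1 as x → 1⁻. -/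
open Real Filter

/-- The function `ϑ(x) = exp((1-x)ln(1-x)/(2x))` on `(0,1)`. -/
noncomputable def thetaFun (x : ℝ) : ℝ :=
  Real.exp ((1 - x) * Real.log (1 - x) / (2 * x))

lemma exp_neg_entropy_eq_thetaFun_mul_sqrt {r : ℝ} (hr : 1 < r) :
    Real.exp (-((r * Real.log r - (r - 1) * Real.log (r - 1)) / 2)) =
      thetaFun r⁻¹ * Real.sqrt r⁻¹ := by
  have h0 : 0 < r := by linarith
  have hsub : 1 - r⁻¹ = (r - 1) / r := by field_simp
  rw [thetaFun, Real.sqrt_eq_rpow, Real.rpow_def_of_pos (inv_pos.2 h0), ← Real.exp_add, hsub,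
    Real.log_div (by linarith) h0.ne', Real.log_inv]
  congr 1
  field_simp
  ring

lemma monotoneOn_thetaFun : MonotoneOn thetaFun (Set.Ioo (0 : ℝ) 1) := by
  intro x hx y hy hxy
  have hsec := Real.convexOn_mul_log.secant_mono (a := 1) (x := 1 - y) (y := 1 - x)
    (by simp) (by simpa using hy.2.le) (by simpa using hx.2.le)
    (by linarith [hy.1]) (by linarith [hx.1]) (by linarith)
  have hslope (t : ℝ) : ((1 - t) * Real.log (1 - t) - 1 * Real.log 1) / (1 - t - 1) =
      -2 * ((1 - t) * Real.log (1 - t) / (2 * t)) := by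
    rw [Real.log_one, mul_zero, sub_zero, sub_sub_cancel_left, div_neg, mul_comm 2 t, ← div_div]
    ring
  rw [hslope, hslope] at hsec
  exact Real.exp_le_exp.2 (by linarith)

lemma tendsto_thetaFun_zero :
    Tendsto thetaFun (nhdsWithin 0 (Set.Ioi (0 : ℝ))) (nhds (1 / Real.sqrt (Real.exp 1))) := by
  have hval : 1 / Real.sqrt (Real.exp 1) = Real.exp (-1 / 2) := by
    rw [← Real.exp_half, one_div, ← Real.exp_neg, neg_div]
  have hderiv : HasDerivAt (fun x : ℝ => (1 - x) * Real.log (1 - x)) (-1) 0 := by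
    have h := (Real.hasDerivAt_mul_log (x := 1 - 0) (by norm_num)).comp (0 : ℝ)
      ((hasDerivAt_id (0 : ℝ)).const_sub 1)
    simpa [Function.comp_def] using h
  have hlim := hderiv.tendsto_slope_zero_right.div_const 2
  rw [hval]
  refine (Real.continuous_exp.tendsto _).comp (hlim.congr fun x => ?_)
  simp only [zero_add, sub_zero, Real.log_one, mul_zero, smul_eq_mul]
  rw [mul_comm 2 x, ← div_div, div_eq_inv_mul _ x]

lemma tendsto_thetaFun_one : Tendsto thetaFun (nhdsWithin 1 (Set.Iio (1 : ℝ))) (nhds 1) := by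
  have hcont : ContinuousAt thetaFun 1 :=
    Real.continuous_exp.continuousAt.comp <|
      (Real.continuous_mul_log.comp (continuous_const.sub continuous_id)).continuousAt.div
        (by fun_prop) (by norm_num)
  have hval : thetaFun 1 = 1 := by simp [thetaFun]
  simpa only [hval] using hcont.tendsto.mono_left nhdsWithin_le_nhds

/-- **Lemma 6.2.**  For `0 < m < n` and
`2β = (n/m)ln(n/m) - (n/m - 1)ln(n/m - 1)` one has `e^{-β} = ϑ(m/n)√(m/n)`, where
`ϑ(x) = exp((1-x)ln(1-x)/(2x))` increases monotonously on `(0,1)` from `1/√e` to `1`. -/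
theorem scaling_factor_theta
    (m n : ℕ) (hm : 0 < m) (hmn : m < n) :
    Real.exp (-((((n : ℝ) / (m : ℝ)) * Real.log ((n : ℝ) / (m : ℝ)) -
          ((n : ℝ) / (m : ℝ) - 1) * Real.log ((n : ℝ) / (m : ℝ) - 1)) / 2))
      = thetaFun ((m : ℝ) / (n : ℝ)) * Real.sqrt ((m : ℝ) / (n : ℝ)) ∧
    MonotoneOn thetaFun (Set.Ioo (0 : ℝ) 1) ∧
    Tendsto thetaFun (nhdsWithin 0 (Set.Ioi (0 : ℝ)))
      (nhds (1 / Real.sqrt (Real.exp 1))) ∧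
    Tendsto thetaFun (nhdsWithin 1 (Set.Iio (1 : ℝ))) (nhds 1) := by
  have hr : (1 : ℝ) < n / m := (one_lt_div (by exact_mod_cast hm)).2 (by exact_mod_cast hmn)
  refine ⟨?_, monotoneOn_thetaFun, tendsto_thetaFun_zero, tendsto_thetaFun_one⟩
  simpa only [inv_div] using exp_neg_entropy_eq_thetaFun_mul_sqrt hr
end

section
/- Let h > 0. For every r > 0 the series h·∑_{k=−∞}^{∞} e^{kh}·exp(−e^{kh}r) converges and equals φ(ln r)/r, where φ is the function φ(s) = h·∑_{k=−∞}^{∞} exp(−e^{kh+s} + kh + s); moreover φ is continuous and h-periodic, i.e., φ(s + h) = φ(s) for all s ∈ ℝ. -/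
open Real

/-- The `h`-periodic function `φ(s) = h ∑_{k∈ℤ} exp(-e^{kh+s} + kh + s)`. -/
noncomputable def phiFun (h : ℝ) (s : ℝ) : ℝ :=
  h * ∑' k : ℤ, Real.exp (-Real.exp ((k : ℝ) * h + s) + ((k : ℝ) * h + s))

theorem neg_exp_add_self_le_neg_abs (t : ℝ) : -Real.exp t + t ≤ -|t| := by
  rcases le_total 0 t with ht | ht
  · rw [abs_of_nonneg ht]
    nlinarith [Real.quadratic_le_exp_of_nonneg ht, sq_nonneg (t - 1)]
  · rw [abs_of_nonpos ht]
    linarith [Real.exp_pos t]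

theorem summable_exp_neg_natAbs_mul {h : ℝ} (hh : 0 < h) :
    Summable fun k : ℤ => Real.exp (-(k.natAbs : ℝ) * h) := by
  have key : Summable fun n : ℕ => Real.exp (-(n : ℝ) * h) := by
    simpa [neg_mul] using Real.summable_exp_nat_mul_iff.2 (neg_lt_zero.2 hh)
  exact Summable.of_nat_of_neg (by simpa using key) (by simpa using key)

theorem exp_neg_exp_add_le {h s R : ℝ} (hh : 0 < h) (hs : |s| ≤ R) (k : ℤ) :
    Real.exp (-Real.exp ((k : ℝ) * h + s) + ((k : ℝ) * h + s)) ≤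
      Real.exp R * Real.exp (-(k.natAbs : ℝ) * h) := by
  rw [← Real.exp_add, Real.exp_le_exp]
  refine (neg_exp_add_self_le_neg_abs _).trans ?_
  have habs : |(k : ℝ) * h| = (k.natAbs : ℝ) * h := by
    rw [abs_mul, abs_of_pos hh, Nat.cast_natAbs, Int.cast_abs]
  have htri := abs_sub ((k : ℝ) * h + s) s
  rw [add_sub_cancel_right, habs] at htri
  linarith

theorem summable_exp_neg_exp_add {h : ℝ} (hh : 0 < h) (s : ℝ) :
    Summable fun k : ℤ => Real.exp (-Real.exp ((k : ℝ) * h + s) + ((k : ℝ) * h + s)) :=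
  ((summable_exp_neg_natAbs_mul hh).mul_left (Real.exp |s|)).of_nonneg_of_le
    (fun _ => (Real.exp_pos _).le) (exp_neg_exp_add_le hh le_rfl)

theorem continuous_phiFun {h : ℝ} (hh : 0 < h) : Continuous (phiFun h) := by
  refine continuous_iff_continuousAt.2 fun s₀ => ?_
  have hcont : ContinuousOn (fun s : ℝ => ∑' k : ℤ,
      Real.exp (-Real.exp ((k : ℝ) * h + s) + ((k : ℝ) * h + s))) {s | |s| < |s₀| + 1} := by
    refine continuousOn_tsum (fun k => by fun_prop)
      ((summable_exp_neg_natAbs_mul hh).mul_left (Real.exp (|s₀| + 1))) fun k s hs => ?_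
    rw [Real.norm_of_nonneg (Real.exp_pos _).le]
    exact exp_neg_exp_add_le hh (le_of_lt hs) k
  have hopen : IsOpen {s : ℝ | |s| < |s₀| + 1} := isOpen_lt continuous_abs continuous_const
  exact (hcont.continuousAt (hopen.mem_nhds (lt_add_one |s₀|))).const_mul h

theorem phiFun_add_period (h s : ℝ) : phiFun h (s + h) = phiFun h s := by
  unfold phiFun
  congr 1
  rw [← (Equiv.addRight (1 : ℤ)).tsum_eq
    (fun k : ℤ => Real.exp (-Real.exp ((k : ℝ) * h + s) + ((k : ℝ) * h + s)))]
  refine tsum_congr fun k => ?_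
  have hk : (k : ℝ) * h + (s + h) = ((Equiv.addRight (1 : ℤ) k : ℤ) : ℝ) * h + s := by
    simp only [Equiv.coe_addRight, Int.cast_add, Int.cast_one]
    ring
  rw [hk]

theorem hasSum_phiFun_log_div {h r : ℝ} (hh : 0 < h) (hr : 0 < r) :
    HasSum (fun k : ℤ => h * Real.exp ((k : ℝ) * h) * Real.exp (-Real.exp ((k : ℝ) * h) * r))
      (phiFun h (Real.log r) / r) := by
  have hsum := ((summable_exp_neg_exp_add hh (Real.log r)).hasSum.mul_left h).div_const r
  refine hsum.congr_fun fun k => ?_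
  rw [Real.exp_add (-_), Real.exp_add, Real.exp_log hr, neg_mul]
  field_simp

/-- For every `h > 0` and `r > 0` the series
`h ∑_{k∈ℤ} e^{kh} exp(-e^{kh} r)` converges and equals `φ(ln r)/r`, where
`φ(s) = h ∑_{k∈ℤ} exp(-e^{kh+s} + kh + s)` is continuous and `h`-periodic. -/
theorem exponential_sum_approximation (h : ℝ) (hh : 0 < h) :
    (∀ r : ℝ, 0 < r →
      HasSum (fun k : ℤ => h * Real.exp ((k : ℝ) * h) * Real.exp (-Real.exp ((k : ℝ) * h) * r))
        (phiFun h (Real.log r) / r)) ∧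
    Continuous (phiFun h) ∧
    (∀ s : ℝ, phiFun h (s + h) = phiFun h s) :=
  ⟨fun _ hr => hasSum_phiFun_log_div hh hr, continuous_phiFun hh, phiFun_add_period h⟩
end
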